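/- arXiv:2303.10658 — 2 statements merged into one kernel-verified Lean document; each statement's English description precedes it below -/
import Mathlib

section
/- Let {F^{ij} : 1 ≤ i < j ≤ 4} be six fundamental matrices such that in each image i the three epipoles e_i^j (j ≠ i) are pairwise parallel. Then {F^{ij}} is compatible if and only if each of the four sub-triples {F^{ij},F^{ik},F^{jk}} (1 ≤ i < j < k ≤ 4) is compatible. -/
open Matrix

/-- The 6×6 matrix whose first three rows form the block `[P₁ | x | 0]` and whose last
three rows form the block `[P₂ | 0 | y]`. -/
noncomputable def bigMat (P₁ P₂ : Matrix (Fin 3) (Fin 4) ℝ) (x y : Fin 3 → ℝ) :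
    Matrix (Fin 6) (Fin 6) ℝ :=
  fun i j =>
    if hi : (i : ℕ) < 3 then
      if hj : (j : ℕ) < 4 then P₁ ⟨(i : ℕ), hi⟩ ⟨(j : ℕ), hj⟩
      else if (j : ℕ) = 4 then x ⟨(i : ℕ), hi⟩ else 0
    else
      if hj : (j : ℕ) < 4 then P₂ ⟨(i : ℕ) - 3, by have := i.isLt; omega⟩ ⟨(j : ℕ), hj⟩
      else if (j : ℕ) = 4 then 0
      else y ⟨(i : ℕ) - 3, by have := i.isLt; omega⟩

/-- `psi P₁ P₂` is the unique 3×3 matrix `F` such that for all `x y : ℝ³`,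
`xᵀ F y = det [P₁ | x | 0; P₂ | 0 | y]`.  (Since the determinant is bilinear in `(x, y)`,
this matrix is obtained by evaluating at pairs of standard basis vectors.) -/
noncomputable def psi (P₁ P₂ : Matrix (Fin 3) (Fin 4) ℝ) : Matrix (Fin 3) (Fin 3) ℝ :=
  fun a b => (bigMat P₁ P₂ (Pi.single a 1) (Pi.single b 1)).det

/-- A camera is a real 3×4 matrix of rank 3. -/
def IsCamera (P : Matrix (Fin 3) (Fin 4) ℝ) : Prop := P.rank = 3

/-- A triple of matrices `{F¹², F¹³, F²³}` is compatible. -/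
def Compat3 (F12 F13 F23 : Matrix (Fin 3) (Fin 3) ℝ) : Prop :=
  ∃ (P₁ P₂ P₃ : Matrix (Fin 3) (Fin 4) ℝ) (l12 l13 l23 : ℝ),
    IsCamera P₁ ∧ IsCamera P₂ ∧ IsCamera P₃ ∧
    l12 ≠ 0 ∧ l13 ≠ 0 ∧ l23 ≠ 0 ∧
    l12 • F12 = psi P₁ P₂ ∧ l13 • F13 = psi P₁ P₃ ∧ l23 • F23 = psi P₂ P₃

/-- The six fundamental matrices `{F i j : i < j}` (on four views) are compatible. -/
def Compat4 (F : Fin 4 → Fin 4 → Matrix (Fin 3) (Fin 3) ℝ) : Prop :=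
  ∃ (P : Fin 4 → Matrix (Fin 3) (Fin 4) ℝ) (lam : Fin 4 → Fin 4 → ℝ),
    (∀ i, IsCamera (P i)) ∧
      ∀ i j, i < j → lam i j ≠ 0 ∧ lam i j • F i j = psi (P i) (P j)

def cr (u v : Fin 3 → ℝ) : Fin 3 → ℝ :=
  ![u 1 * v 2 - u 2 * v 1, u 2 * v 0 - u 0 * v 2, u 0 * v 1 - u 1 * v 0]

def skw (e : Fin 3 → ℝ) : Matrix (Fin 3) (Fin 3) ℝ :=
  !![0, -e 2, e 1; e 2, 0, -e 0; -e 1, e 0, 0]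

/-- cross product of columns -/
def cc (P : Matrix (Fin 3) (Fin 4) ℝ) (i j : Fin 4) : Fin 3 → ℝ :=
  cr (fun a => P a i) (fun a => P a j)

set_option maxRecDepth 20000 in
set_option maxHeartbeats 4000000 in
theorem det_big (P Q : Matrix (Fin 3) (Fin 4) ℝ) (x y : Fin 3 → ℝ) :
    (bigMat P Q x y).det =
      ((cc P 0 1 ⬝ᵥ x) * (cc Q 2 3 ⬝ᵥ y) - (cc P 0 2 ⬝ᵥ x) * (cc Q 1 3 ⬝ᵥ y)
      + (cc P 0 3 ⬝ᵥ x) * (cc Q 1 2 ⬝ᵥ y) + (cc P 1 2 ⬝ᵥ x) * (cc Q 0 3 ⬝ᵥ y)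
      - (cc P 1 3 ⬝ᵥ x) * (cc Q 0 2 ⬝ᵥ y) + (cc P 2 3 ⬝ᵥ x) * (cc Q 0 1 ⬝ᵥ y)) := by
  have hM : bigMat P Q x y = !![P 0 0, P 0 1, P 0 2, P 0 3, x 0, 0;
     P 1 0, P 1 1, P 1 2, P 1 3, x 1, 0;
     P 2 0, P 2 1, P 2 2, P 2 3, x 2, 0;
     Q 0 0, Q 0 1, Q 0 2, Q 0 3, 0, y 0;
     Q 1 0, Q 1 1, Q 1 2, Q 1 3, 0, y 1;
     Q 2 0, Q 2 1, Q 2 2, Q 2 3, 0, y 2] := by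
    ext i j
    fin_cases i <;> fin_cases j <;> simp [bigMat]
  rw [hM, det_succ_column _ 5]
  simp only [Fin.sum_univ_succ, det_succ_column _ (4 : Fin 5)]
  simp [Fin.sum_univ_succ, det_succ_row_zero, Fin.succAbove, cc, cr, dotProduct]
  ring1

theorem psi_apply (P Q : Matrix (Fin 3) (Fin 4) ℝ) (a b : Fin 3) :
    psi P Q a b = cc P 0 1 a * cc Q 2 3 b - cc P 0 2 a * cc Q 1 3 b
      + cc P 0 3 a * cc Q 1 2 b + cc P 1 2 a * cc Q 0 3 b
      - cc P 1 3 a * cc Q 0 2 b + cc P 2 3 a * cc Q 0 1 b := by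
  simp [psi, det_big]

theorem det_big_psi (P Q : Matrix (Fin 3) (Fin 4) ℝ) (x y : Fin 3 → ℝ) :
    (bigMat P Q x y).det = x ⬝ᵥ (psi P Q *ᵥ y) := by
  rw [det_big]
  simp only [dotProduct, mulVec, Fin.sum_univ_three, psi_apply]
  ring

/-- extend a 4×4 matrix by the identity -/
def ext6 (H : Matrix (Fin 4) (Fin 4) ℝ) : Matrix (Fin 6) (Fin 6) ℝ :=
  !![H 0 0, H 0 1, H 0 2, H 0 3, 0, 0;
     H 1 0, H 1 1, H 1 2, H 1 3, 0, 0;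
     H 2 0, H 2 1, H 2 2, H 2 3, 0, 0;
     H 3 0, H 3 1, H 3 2, H 3 3, 0, 0;
     0, 0, 0, 0, 1, 0;
     0, 0, 0, 0, 0, 1]

theorem ext6_mul (H K : Matrix (Fin 4) (Fin 4) ℝ) : ext6 H * ext6 K = ext6 (H * K) := by
  ext i j
  fin_cases i <;> fin_cases j <;>
    simp [ext6, Matrix.mul_apply, Fin.sum_univ_succ]

theorem ext6_one : ext6 1 = 1 := by
  ext i j
  fin_cases i <;> fin_cases j <;> simp [ext6]

theorem big_mul (P Q : Matrix (Fin 3) (Fin 4) ℝ) (H : Matrix (Fin 4) (Fin 4) ℝ)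
    (x y : Fin 3 → ℝ) : bigMat (P * H) (Q * H) x y = bigMat P Q x y * ext6 H := by
  ext i j
  fin_cases i <;> fin_cases j <;>
    simp [ext6, bigMat, Matrix.mul_apply, Fin.sum_univ_succ]

theorem psi_mul (P Q : Matrix (Fin 3) (Fin 4) ℝ) (H : Matrix (Fin 4) (Fin 4) ℝ) :
    psi (P * H) (Q * H) = (ext6 H).det • psi P Q := by
  ext a b
  simp [psi, big_mul, mul_comm]

theorem ext6_det (H : Matrix (Fin 4) (Fin 4) ℝ) (hH : H.det ≠ 0) : (ext6 H).det ≠ 0 := by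
  have h : ext6 H * ext6 H⁻¹ = 1 := by
    rw [ext6_mul, Matrix.mul_nonsing_inv _ (isUnit_iff_ne_zero.mpr hH), ext6_one]
  have := congrArg Matrix.det h
  rw [Matrix.det_mul, Matrix.det_one] at this
  exact left_ne_zero_of_mul (this ▸ one_ne_zero)

theorem psi_right_zero (P Q : Matrix (Fin 3) (Fin 4) ℝ) (c : Fin 4 → ℝ)
    (h : P *ᵥ c = 0) : psi P Q *ᵥ (Q *ᵥ c) = 0 := by
  have key : ∀ x, x ⬝ᵥ (psi P Q *ᵥ (Q *ᵥ c)) = 0 := by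
    intro x
    rw [← det_big_psi]
    apply Matrix.exists_mulVec_eq_zero_iff.mp
    refine ⟨![c 0, c 1, c 2, c 3, 0, -1], fun h => ?_, ?_⟩
    · have := congrFun h 5
      simp at this
    · ext i
      have h0 := congrFun h 0
      have h1 := congrFun h 1
      have h2 := congrFun h 2
      simp [mulVec, dotProduct, Fin.sum_univ_succ] at h0 h1 h2
      fin_cases i <;>
      simp [bigMat, mulVec, dotProduct, Fin.sum_univ_succ] <;> linarith
  exact dotProduct_eq_zero _ (fun x => by rw [dotProduct_comm]; exact key x)

theorem psi_left_zero (P Q : Matrix (Fin 3) (Fin 4) ℝ) (c : Fin 4 → ℝ)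
    (h : Q *ᵥ c = 0) : (psi P Q)ᵀ *ᵥ (P *ᵥ c) = 0 := by
  have key : ∀ y, ((psi P Q)ᵀ *ᵥ (P *ᵥ c)) ⬝ᵥ y = 0 := by
    intro x
    rw [mulVec_transpose, ← dotProduct_mulVec, ← det_big_psi]
    apply Matrix.exists_mulVec_eq_zero_iff.mp
    refine ⟨![c 0, c 1, c 2, c 3, -1, 0], fun h => ?_, ?_⟩
    · have := congrFun h 4
      simp at this
    · ext i
      have h0 := congrFun h 0
      have h1 := congrFun h 1
      have h2 := congrFun h 2
      simp [mulVec, dotProduct, Fin.sum_univ_succ] at h0 h1 h2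
      fin_cases i <;>
      simp [bigMat, mulVec, dotProduct, Fin.sum_univ_succ] <;> linarith
  exact dotProduct_eq_zero _ key

theorem psi_eq_zero (P Q : Matrix (Fin 3) (Fin 4) ℝ) (c : Fin 4 → ℝ)
    (hc : c ≠ 0) (hP : P *ᵥ c = 0) (h : Q *ᵥ c = 0) : psi P Q = 0 := by
  ext a b
  apply Matrix.exists_mulVec_eq_zero_iff.mp
  refine ⟨![c 0, c 1, c 2, c 3, 0, 0], fun h => hc ?_, ?_⟩
  · have h0 := congrFun h 0
    have h1 := congrFun h 1
    have h2 := congrFun h 2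
    have h3 := congrFun h 3
    ext i
    fin_cases i <;> simp_all
  · ext i
    have h0 := congrFun h 0
    have h1 := congrFun h 1
    have h2 := congrFun h 2
    have g0 := congrFun hP 0
    have g1 := congrFun hP 1
    have g2 := congrFun hP 2
    simp [mulVec, dotProduct, Fin.sum_univ_succ] at h0 h1 h2 g0 g1 g2
    fin_cases i <;>
    simp [bigMat, mulVec, dotProduct, Fin.sum_univ_succ] <;> linarith

theorem ker_line (F : Matrix (Fin 3) (Fin 3) ℝ) (hF : F.rank = 2) (v w : Fin 3 → ℝ)
    (hv : v ≠ 0) (h : F *ᵥ v = 0) (h' : F *ᵥ w = 0) : ∃ c : ℝ, w = c • v := by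
  have h1 := F.mulVecLin.finrank_range_add_finrank_ker
  have h2 : Module.finrank ℝ (LinearMap.ker F.mulVecLin) = 1 := by
    have : Module.finrank ℝ (LinearMap.range F.mulVecLin) = 2 := hF
    simp at h1
    omega
  have := (finrank_eq_one_iff_of_nonzero' (⟨v, by simpa using h⟩ : LinearMap.ker F.mulVecLin)
    (by simpa [Subtype.ext_iff] using hv)).mp h2 ⟨w, by simpa using h'⟩
  obtain ⟨c, hc⟩ := this
  exact ⟨c, by simpa using (congrArg Subtype.val hc).symm⟩

theorem cam_ker (P : Matrix (Fin 3) (Fin 4) ℝ) : ∃ c : Fin 4 → ℝ, c ≠ 0 ∧ P *ᵥ c = 0 := by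
  have h := LinearMap.ker_ne_bot_of_finrank_lt (f := P.mulVecLin) (by simp)
  obtain ⟨c, h1, h2⟩ := Submodule.exists_mem_ne_zero_of_ne_bot h
  exact ⟨c, h2, by simpa using h1⟩

theorem cam_surj (P : Matrix (Fin 3) (Fin 4) ℝ) (hP : IsCamera P) (q : Fin 3 → ℝ) :
    ∃ X, P *ᵥ X = q := by
  have : LinearMap.range P.mulVecLin = ⊤ := by
    apply Submodule.eq_top_of_finrank_eq
    have : Module.finrank ℝ (LinearMap.range P.mulVecLin) = 3 := hP
    simp [this]
  exact LinearMap.range_eq_top.mp this q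

theorem exists_basis (e : Fin 3 → ℝ) (he : e ≠ 0) : ∃ q1 q2 : Fin 3 → ℝ, cr q1 q2 ⬝ᵥ e ≠ 0 := by
  obtain ⟨i, hi⟩ := Function.ne_iff.mp he
  fin_cases i
  · exact ⟨![0,1,0], ![0,0,1], by simpa [cr, dotProduct, Fin.sum_univ_three] using hi⟩
  · exact ⟨![0,0,1], ![1,0,0], by simpa [cr, dotProduct, Fin.sum_univ_three] using hi⟩
  · exact ⟨![1,0,0], ![0,1,0], by simpa [cr, dotProduct, Fin.sum_univ_three] using hi⟩

theorem sq_pos' (e : Fin 3 → ℝ) (he : e ≠ 0) : e ⬝ᵥ e ≠ 0 := by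
  simpa using he

theorem core_normal (P0 P1 P2 : Matrix (Fin 3) (Fin 4) ℝ) (e2 : Fin 3 → ℝ) (σ τ : ℝ)
    (h0 : ∀ i, P0 i 3 = 0) (h1 : ∀ i, P1 i 2 = 0)
    (h2 : ∀ i, P2 i 2 = σ * e2 i) (h3 : ∀ i, P2 i 3 = τ * e2 i) :
    (τ * (cc P0 0 2 ⬝ᵥ (skw (fun i => P0 i 2) *ᵥ cc P0 1 2))) • psi P1 P2 =
      σ • ((psi P0 P1)ᵀ * skw (fun i => P0 i 2) * psi P0 P2) := by
  have a1 : psi P0 P1 = of fun a b => cc P0 1 2 a * cc P1 0 3 b - cc P0 0 2 a * cc P1 1 3 b := by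
    ext a b
    have e1 : cc P0 0 3 = 0 := by ext i; fin_cases i <;> simp [cc, cr, h0]
    have e2 : cc P0 1 3 = 0 := by ext i; fin_cases i <;> simp [cc, cr, h0]
    have e3 : cc P0 2 3 = 0 := by ext i; fin_cases i <;> simp [cc, cr, h0]
    have e4 : cc P1 2 3 = 0 := by ext i; fin_cases i <;> simp [cc, cr, h1]
    simp [psi_apply, e1, e2, e3, e4]; ring
  have b3 : cc P2 0 3 = τ • cr (fun i => P2 i 0) e2 := by
    ext i; fin_cases i <;> simp [cc, cr, h3] <;> ring
  have b4 : cc P2 1 3 = τ • cr (fun i => P2 i 1) e2 := by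
    ext i; fin_cases i <;> simp [cc, cr, h3] <;> ring
  have b5 : cc P2 0 2 = σ • cr (fun i => P2 i 0) e2 := by
    ext i; fin_cases i <;> simp [cc, cr, h2] <;> ring
  have b6 : cc P2 1 2 = σ • cr (fun i => P2 i 1) e2 := by
    ext i; fin_cases i <;> simp [cc, cr, h2] <;> ring
  have b7 : cc P2 2 3 = 0 := by
    ext i; fin_cases i <;> simp [cc, cr, h2, h3] <;> ring
  have a2 : psi P0 P2 = of fun a b => τ * (cc P0 1 2 a * cr (fun i => P2 i 0) e2 b
      - cc P0 0 2 a * cr (fun i => P2 i 1) e2 b) := by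
    ext a b
    have e1 : cc P0 0 3 = 0 := by ext i; fin_cases i <;> simp [cc, cr, h0]
    have e2 : cc P0 1 3 = 0 := by ext i; fin_cases i <;> simp [cc, cr, h0]
    have e3 : cc P0 2 3 = 0 := by ext i; fin_cases i <;> simp [cc, cr, h0]
    simp [psi_apply, e1, e2, e3, b3, b4, b7]; ring
  have a3 : psi P1 P2 = of fun a b => σ * (cc P1 0 3 a * cr (fun i => P2 i 1) e2 b
      - cc P1 1 3 a * cr (fun i => P2 i 0) e2 b) := by
    ext a b
    have e1 : cc P1 0 2 = 0 := by ext i; fin_cases i <;> simp [cc, cr, h1]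
    have e2 : cc P1 1 2 = 0 := by ext i; fin_cases i <;> simp [cc, cr, h1]
    have e3 : cc P1 2 3 = 0 := by ext i; fin_cases i <;> simp [cc, cr, h1]
    simp [psi_apply, e1, e2, e3, b5, b6, b7]; ring
  rw [a1, a2, a3]
  generalize cc P0 1 2 = q
  generalize cc P0 0 2 = p
  generalize cc P1 0 3 = u
  generalize cc P1 1 3 = v
  generalize cr (fun i => P2 i 0) e2 = s
  generalize cr (fun i => P2 i 1) e2 = t
  generalize (fun i => P0 i 2) = e
  ext a b
  simp [Matrix.mul_apply, mulVec, dotProduct, Fin.sum_univ_three, skw]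
  ring

theorem d_eq (q1 q2 e : Fin 3 → ℝ) :
    cr q1 e ⬝ᵥ (skw e *ᵥ cr q2 e) = -((e ⬝ᵥ e) * (cr q1 q2 ⬝ᵥ e)) := by
  simp [mulVec, dotProduct, Fin.sum_univ_three, skw, cr]
  ring

theorem core (P0 P1 P2 : Matrix (Fin 3) (Fin 4) ℝ) (e2 : Fin 3 → ℝ) (σ τ : ℝ)
    (hP0 : IsCamera P0) (c0 c1 : Fin 4 → ℝ) (hc0 : c0 ≠ 0) (h0 : P0 *ᵥ c0 = 0)
    (h1 : P1 *ᵥ c1 = 0) (he : P0 *ᵥ c1 ≠ 0) (h2 : P2 *ᵥ c1 = σ • e2) (h3 : P2 *ᵥ c0 = τ • e2)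
    (hσ : σ ≠ 0) (hτ : τ ≠ 0) :
    ∃ k : ℝ, k ≠ 0 ∧ psi P1 P2 = k • ((psi P0 P1)ᵀ * skw (P0 *ᵥ c1) * psi P0 P2) := by
  obtain ⟨q1, q2, hq⟩ := exists_basis _ he
  obtain ⟨X1, hX1⟩ := cam_surj P0 hP0 q1
  obtain ⟨X2, hX2⟩ := cam_surj P0 hP0 q2
  let H : Matrix (Fin 4) (Fin 4) ℝ := of fun i j => ![X1, X2, c1, c0] j i
  have hcol : ∀ (P : Matrix (Fin 3) (Fin 4) ℝ) i j, (P * H) i j = (P *ᵥ (![X1, X2, c1, c0] j)) i := by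
    intro P i j
    simp [Matrix.mul_apply, mulVec, dotProduct, H]
  have hd : (cc (P0 * H) 0 2 ⬝ᵥ (skw (fun i => (P0 * H) i 2) *ᵥ cc (P0 * H) 1 2)) ≠ 0 := by
    have e1 : (fun i => (P0 * H) i 2) = P0 *ᵥ c1 := by ext i; simp [hcol]
    have e2 : cc (P0 * H) 0 2 = cr q1 (P0 *ᵥ c1) := by simp [cc, hcol, ← hX1]
    have e3 : cc (P0 * H) 1 2 = cr q2 (P0 *ᵥ c1) := by simp [cc, hcol, ← hX2]
    rw [e1, e2, e3, d_eq]
    exact neg_ne_zero.mpr (mul_ne_zero (sq_pos' _ he) hq)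
  have hH : H.det ≠ 0 := by
    intro h
    obtain ⟨v, hv, hHv⟩ := Matrix.exists_mulVec_eq_zero_iff.mpr h
    have w : v 0 • X1 + v 1 • X2 + v 2 • c1 + v 3 • c0 = 0 := by
      rw [← hHv]
      ext i
      simp [mulVec, dotProduct, H, Fin.sum_univ_four]; ring
    have w2 := congrArg (fun x => P0 *ᵥ x) w
    simp only [mulVec_add, mulVec_smul, hX1, hX2, h0, mulVec_zero, smul_zero, add_zero] at w2
    generalize P0 *ᵥ c1 = e at *
    have g0 := congrFun w2 0
    have g1 := congrFun w2 1
    have g2 := congrFun w2 2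
    simp at g0 g1 g2
    simp [cr, dotProduct, Fin.sum_univ_three] at hq
    have v0 : v 0 = 0 := by
      apply (mul_eq_zero.mp _).resolve_right hq
      linear_combination (q2 1 * e 2 - q2 2 * e 1) * g0 + (q2 2 * e 0 - q2 0 * e 2) * g1 + (q2 0 * e 1 - q2 1 * e 0) * g2
    have v1 : v 1 = 0 := by
      apply (mul_eq_zero.mp _).resolve_right hq
      linear_combination -(q1 1 * e 2 - q1 2 * e 1) * g0 - (q1 2 * e 0 - q1 0 * e 2) * g1 - (q1 0 * e 1 - q1 1 * e 0) * g2
    have v2 : v 2 = 0 := by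
      apply (mul_eq_zero.mp _).resolve_right hq
      linear_combination (q1 1 * q2 2 - q1 2 * q2 1) * g0 + (q1 2 * q2 0 - q1 0 * q2 2) * g1 + (q1 0 * q2 1 - q1 1 * q2 0) * g2
    have v3 : v 3 = 0 := by
      simpa [v0, v1, v2, hc0] using w
    apply hv
    ext i
    fin_cases i <;> simp [v0, v1, v2, v3]
  have hx := ext6_det H hH
  have main := core_normal (P0 * H) (P1 * H) (P2 * H) e2 σ τ
    (by intro i; simp [hcol, h0]) (by intro i; simp [hcol, h1])
    (by intro i; simp [hcol, h2]) (by intro i; simp [hcol, h3])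
  have e1 : (fun i => (P0 * H) i 2) = P0 *ᵥ c1 := by ext i; simp [hcol]
  generalize (cc (P0 * H) 0 2 ⬝ᵥ (skw (fun i => (P0 * H) i 2) *ᵥ cc (P0 * H) 1 2)) = d at hd main
  rw [e1] at main
  simp only [psi_mul, transpose_smul, Matrix.smul_mul, Matrix.mul_smul, smul_smul] at main
  generalize (ext6 H).det = x at hx main
  refine ⟨(τ * d * x)⁻¹ * (σ * (x * x)), by positivity, ?_⟩
  rw [← smul_smul, eq_inv_smul_iff₀ (by positivity), main]

theorem triple (P0 P1 P2 : Matrix (Fin 3) (Fin 4) ℝ) (F01 F02 F12 : Matrix (Fin 3) (Fin 3) ℝ)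
    (l01 l02 l12 : ℝ) (hP0 : IsCamera P0)
    (k01 : l01 ≠ 0) (k02 : l02 ≠ 0) (k12 : l12 ≠ 0)
    (r01 : F01.rank = 2) (r02 : F02.rank = 2) (r12 : F12.rank = 2)
    (p01 : l01 • F01 = psi P0 P1) (p02 : l02 • F02 = psi P0 P2) (p12 : l12 • F12 = psi P1 P2)
    (e e2 : Fin 3 → ℝ) (he : e ≠ 0) (he2 : e2 ≠ 0) (z01 : F01ᵀ *ᵥ e = 0)
    (z02 : F02 *ᵥ e2 = 0) (z12 : F12 *ᵥ e2 = 0) :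
    ∃ k : ℝ, k ≠ 0 ∧ F12 = k • (F01ᵀ * skw e * F02) := by
  obtain ⟨c0, hc0, g0⟩ := cam_ker P0
  obtain ⟨c1, hc1, g1⟩ := cam_ker P1
  have nz : ∀ (F : Matrix (Fin 3) (Fin 3) ℝ) (l : ℝ), l ≠ 0 → F.rank = 2 → l • F ≠ 0 := by
    intro F l hl hF h
    have : F = 0 := (smul_eq_zero.mp h).resolve_left hl
    simp [this] at hF
  have n1 : P0 *ᵥ c1 ≠ 0 := fun h => nz _ _ k01 r01 (p01.trans (psi_eq_zero _ _ c1 hc1 h g1))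
  have n2 : P2 *ᵥ c0 ≠ 0 := fun h => nz _ _ k02 r02 (p02.trans (psi_eq_zero _ _ c0 hc0 g0 h))
  have n3 : P2 *ᵥ c1 ≠ 0 := fun h => nz _ _ k12 r12 (p12.trans (psi_eq_zero _ _ c1 hc1 g1 h))
  have m1 : F01ᵀ *ᵥ (P0 *ᵥ c1) = 0 := by
    have := psi_left_zero P0 P1 c1 g1
    rw [← p01, transpose_smul, smul_mulVec] at this
    exact (smul_eq_zero.mp this).resolve_left k01
  have m2 : F02 *ᵥ (P2 *ᵥ c0) = 0 := by
    have := psi_right_zero P0 P2 c0 g0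
    rw [← p02, smul_mulVec] at this
    exact (smul_eq_zero.mp this).resolve_left k02
  have m3 : F12 *ᵥ (P2 *ᵥ c1) = 0 := by
    have := psi_right_zero P1 P2 c1 g1
    rw [← p12, smul_mulVec] at this
    exact (smul_eq_zero.mp this).resolve_left k12
  obtain ⟨α, hα⟩ := ker_line _ (by rwa [rank_transpose]) _ _ he z01 m1
  obtain ⟨τ, hτ⟩ := ker_line _ r02 _ _ he2 z02 m2
  obtain ⟨σ, hσ⟩ := ker_line _ r12 _ _ he2 z12 m3
  have α0 : α ≠ 0 := by rintro rfl; simp at hα; exact n1 hα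
  have τ0 : τ ≠ 0 := by rintro rfl; simp at hτ; exact n2 hτ
  have σ0 : σ ≠ 0 := by rintro rfl; simp at hσ; exact n3 hσ
  obtain ⟨k, hk, h⟩ := core P0 P1 P2 e2 σ τ hP0 c0 c1 hc0 g0 g1 n1 hσ hτ σ0 τ0
  have hs : skw (α • e) = α • skw e := by
    ext i j; fin_cases i <;> fin_cases j <;> simp [skw]
  rw [← p12, ← p01, ← p02, hα, hs] at h
  simp only [transpose_smul, Matrix.smul_mul, Matrix.mul_smul, smul_smul] at h
  refine ⟨l12⁻¹ * (k * (l02 * (α * l01))), by positivity, ?_⟩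
  rw [← smul_smul, eq_inv_smul_iff₀ k12, h]

/-- the reference camera -/
def cam0 : Matrix (Fin 3) (Fin 4) ℝ := !![1, 0, 0, 0; 0, 1, 0, 0; 0, 0, 1, 0]

/-- the other cameras -/
def camj (e0 e : Fin 3 → ℝ) (F : Matrix (Fin 3) (Fin 3) ℝ) (t : ℝ) : Matrix (Fin 3) (Fin 4) ℝ :=
  of fun i j => if h : (j : ℕ) < 3 then (skw e * Fᵀ) i ⟨j, h⟩ + t * e i * e0 ⟨j, h⟩ else e i

theorem rank_of_rows (P : Matrix (Fin 3) (Fin 4) ℝ) (h : ∀ u, u ᵥ* P = 0 → u = 0) :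
    IsCamera P := by
  have h1 : Function.Injective P.vecMulLinear :=
    (injective_iff_map_eq_zero _).mpr (fun u hu => h u (by simpa using hu))
  have h2 : LinearIndependent ℝ P.row := Matrix.vecMul_injective_iff.mp (fun a b hab => h1 hab)
  simpa [IsCamera] using h2.rank_matrix

theorem cam0_camera : IsCamera cam0 := by
  apply rank_of_rows
  intro u hu
  have h0 := congrFun hu 0
  have h1 := congrFun hu 1
  have h2 := congrFun hu 2
  simp [cam0, vecMul, dotProduct, Fin.sum_univ_three] at h0 h1 h2
  ext i
  fin_cases i <;> simp [h0, h1, h2]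

theorem camj_camera (e0 e : Fin 3 → ℝ) (F : Matrix (Fin 3) (Fin 3) ℝ) (t : ℝ)
    (he : e ≠ 0) (hF : F.rank = 2) (hz : F *ᵥ e = 0) : IsCamera (camj e0 e F t) := by
  apply rank_of_rows
  intro u hu
  have h0 := congrFun hu 0
  have h1 := congrFun hu 1
  have h2 := congrFun hu 2
  have h3 := congrFun hu 3
  have hn := sq_pos' e he
  simp [camj, vecMul, dotProduct, Fin.sum_univ_three, Matrix.mul_apply, skw] at h0 h1 h2 h3 hn
  have hc : F *ᵥ cr u e = 0 := by
    ext i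
    fin_cases i <;> simp [mulVec, dotProduct, Fin.sum_univ_three, cr]
    · linear_combination h0 - t * e0 0 * h3
    · linear_combination h1 - t * e0 1 * h3
    · linear_combination h2 - t * e0 2 * h3
  obtain ⟨c, hc⟩ := ker_line F hF _ _ he hz hc
  have g0 := congrFun hc 0
  have g1 := congrFun hc 1
  have g2 := congrFun hc 2
  simp [cr] at g0 g1 g2
  have c0 : c = 0 := by
    apply (mul_eq_zero.mp _).resolve_right hn
    linear_combination -e 0 * g0 - e 1 * g1 - e 2 * g2
  subst c0
  ext i
  fin_cases i <;> simp <;> apply (mul_eq_zero.mp _).resolve_right hn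
  · linear_combination e 0 * h3 + e 1 * (g2) - e 2 * g1
  · linear_combination e 1 * h3 + e 2 * (g0) - e 0 * g2
  · linear_combination e 2 * h3 + e 0 * (g1) - e 1 * g0

theorem psi_cam0 (e0 e : Fin 3 → ℝ) (F : Matrix (Fin 3) (Fin 3) ℝ) (t : ℝ)
    (hz : F *ᵥ e = 0) : psi cam0 (camj e0 e F t) = (e ⬝ᵥ e) • F := by
  have h0 := congrFun hz 0
  have h1 := congrFun hz 1
  have h2 := congrFun hz 2
  simp [mulVec, dotProduct, Fin.sum_univ_three] at h0 h1 h2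
  ext a b
  rw [psi_apply]
  fin_cases a <;> fin_cases b <;>
    simp [cc, cr, cam0, camj, dotProduct, Fin.sum_univ_three, Matrix.mul_apply, skw]
  · linear_combination -e 0 * h0
  · linear_combination -e 1 * h0
  · linear_combination -e 2 * h0
  · linear_combination -e 0 * h1
  · linear_combination -e 1 * h1
  · linear_combination -e 2 * h1
  · linear_combination -e 0 * h2
  · linear_combination -e 1 * h2
  · linear_combination -e 2 * h2

theorem camj_mul (e0 e : Fin 3 → ℝ) (F : Matrix (Fin 3) (Fin 3) ℝ) (t s : ℝ)
    (hz : Fᵀ *ᵥ e0 = 0) : camj e0 e F t *ᵥ ![e0 0, e0 1, e0 2, -(s * (e0 ⬝ᵥ e0))]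
      = ((t - s) * (e0 ⬝ᵥ e0)) • e := by
  have h0 := congrFun hz 0
  have h1 := congrFun hz 1
  have h2 := congrFun hz 2
  simp [mulVec, dotProduct, Fin.sum_univ_three] at h0 h1 h2
  ext i
  fin_cases i <;>
    simp [camj, dotProduct, mulVec, Fin.sum_univ_succ, Matrix.mul_apply, skw]
  · linear_combination -e 2 * h1 + e 1 * h2
  · linear_combination -e 0 * h2 + e 2 * h0
  · linear_combination -e 1 * h0 + e 0 * h1

theorem constr (e0 e1 e2 : Fin 3 → ℝ) (F01 F02 : Matrix (Fin 3) (Fin 3) ℝ) (s t : ℝ)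
    (hst : t ≠ s) (n0 : e0 ≠ 0) (n1 : e1 ≠ 0) (n2 : e2 ≠ 0)
    (z1 : F01 *ᵥ e1 = 0) (z2 : F02 *ᵥ e2 = 0) (w1 : F01ᵀ *ᵥ e0 = 0) (w2 : F02ᵀ *ᵥ e0 = 0) :
    ∃ k : ℝ, k ≠ 0 ∧ psi (camj e0 e1 F01 s) (camj e0 e2 F02 t) = k • (F01ᵀ * skw e0 * F02) := by
  have hc : cam0 *ᵥ ![e0 0, e0 1, e0 2, -(s * (e0 ⬝ᵥ e0))] = e0 := by
    ext i
    fin_cases i <;> simp [cam0, mulVec, dotProduct, Fin.sum_univ_succ]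
  obtain ⟨k, hk, h⟩ := core cam0 (camj e0 e1 F01 s) (camj e0 e2 F02 t) e2 ((t - s) * (e0 ⬝ᵥ e0)) 1
    cam0_camera ![0, 0, 0, 1] ![e0 0, e0 1, e0 2, -(s * (e0 ⬝ᵥ e0))]
    (fun h => by simpa using congrFun h 3)
    (by ext i; fin_cases i <;> simp [cam0, mulVec, dotProduct, Fin.sum_univ_succ])
    (by rw [camj_mul _ _ _ _ _ w1]; simp) (by rwa [hc]) (camj_mul _ _ _ _ _ w2)
    (by ext i; fin_cases i <;> simp [camj, mulVec, dotProduct, Fin.sum_univ_succ])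
    (mul_ne_zero (sub_ne_zero.mpr hst) (sq_pos' _ n0)) one_ne_zero
  rw [hc, psi_cam0 _ _ _ _ z1, psi_cam0 _ _ _ _ z2] at h
  simp only [transpose_smul, Matrix.smul_mul, Matrix.mul_smul, smul_smul] at h
  exact ⟨_, mul_ne_zero hk (mul_ne_zero (sq_pos' _ n2) (sq_pos' _ n1)), by rw [h]⟩

theorem finish (F A B : Matrix (Fin 3) (Fin 3) ℝ) (h1 : ∃ k : ℝ, k ≠ 0 ∧ F = k • A)
    (h2 : ∃ k : ℝ, k ≠ 0 ∧ B = k • A) : ∃ l : ℝ, l ≠ 0 ∧ l • F = B := by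
  obtain ⟨k, hk, rfl⟩ := h1
  obtain ⟨m, hm, rfl⟩ := h2
  exact ⟨m * k⁻¹, by positivity, by rw [smul_smul, inv_mul_cancel_right₀ hk]⟩

/-- Case 4: all three epipoles in each image are pairwise parallel.
Here `e i j` denotes the epipole `e_j^i`. -/
theorem stmt15 (F : Fin 4 → Fin 4 → Matrix (Fin 3) (Fin 3) ℝ)
    (hsym : ∀ i j, F j i = (F i j)ᵀ)
    (hrank : ∀ i j, i ≠ j → (F i j).rank = 2)
    (e : Fin 4 → Fin 4 → (Fin 3 → ℝ))
    (he : ∀ i j, i ≠ j → e i j ≠ 0 ∧ F i j *ᵥ e i j = 0)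
    (hpar : ∀ i j k : Fin 4, j ≠ i → k ≠ i → ∃ c : ℝ, e j i = c • e k i) :
    Compat4 F ↔
      (Compat3 (F 0 1) (F 0 2) (F 1 2) ∧ Compat3 (F 0 1) (F 0 3) (F 1 3) ∧
        Compat3 (F 0 2) (F 0 3) (F 2 3) ∧ Compat3 (F 1 2) (F 1 3) (F 2 3)) := by

  constructor
  · rintro ⟨P, lam, hP, h⟩
    have tr : ∀ i j k, i < j → j < k → Compat3 (F i j) (F i k) (F j k) := fun i j k hij hjk =>
      ⟨P i, P j, P k, lam i j, lam i k, lam j k, hP i, hP j, hP k, (h i j hij).1,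
        (h i k (hij.trans hjk)).1, (h j k hjk).1, (h i j hij).2,
        (h i k (hij.trans hjk)).2, (h j k hjk).2⟩
    exact ⟨tr 0 1 2 (by decide) (by decide), tr 0 1 3 (by decide) (by decide),
      tr 0 2 3 (by decide) (by decide), tr 1 2 3 (by decide) (by decide)⟩
  · rintro ⟨h012, h013, h023, -⟩
    have n0 : e 1 0 ≠ 0 := (he 1 0 (by decide)).1
    have w : ∀ j, j ≠ 0 → (F 0 j)ᵀ *ᵥ e 1 0 = 0 := by
      intro j hj
      obtain ⟨c, hc⟩ := hpar 0 1 j (by decide) hj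
      rw [← hsym, hc, mulVec_smul, (he j 0 hj).2, smul_zero]
    have n : ∀ j, j ≠ 0 → e 0 j ≠ 0 := fun j hj => (he 0 j hj.symm).1
    have z : ∀ j, j ≠ 0 → F 0 j *ᵥ e 0 j = 0 := fun j hj => (he 0 j hj.symm).2
    have z' : ∀ i j, j ≠ 0 → i ≠ j → F i j *ᵥ e 0 j = 0 := by
      intro i j hj hij
      obtain ⟨c, hc⟩ := hpar j 0 i hj.symm hij
      rw [hc, mulVec_smul, (he i j hij).2, smul_zero]
    have T : ∀ i j, i ≠ 0 → j ≠ 0 → i ≠ j → Compat3 (F 0 i) (F 0 j) (F i j) →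
        ∃ k : ℝ, k ≠ 0 ∧ F i j = k • ((F 0 i)ᵀ * skw (e 1 0) * F 0 j) := by
      rintro i j hi hj hij ⟨P0, P1, P2, l01, l02, l12, c0, -, -, k01, k02, k12, p01, p02, p12⟩
      exact triple P0 P1 P2 _ _ _ l01 l02 l12 c0 k01 k02 k12 (hrank _ _ hi.symm)
        (hrank _ _ hj.symm) (hrank _ _ hij) p01 p02 p12 (e 1 0) (e 0 j) n0 (n j hj)
        (w i hi) (z j hj) (z' i j hj hij)
    let C : Fin 4 → Matrix (Fin 3) (Fin 4) ℝ := fun j => camj (e 1 0) (e 0 j) (F 0 j) (j : ℕ)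
    let P : Fin 4 → Matrix (Fin 3) (Fin 4) ℝ := fun j => if j = 0 then cam0 else C j
    have A0 : ∀ j, j ≠ 0 → ∃ l : ℝ, l ≠ 0 ∧ l • F 0 j = psi (P 0) (P j) := by
      intro j hj
      refine ⟨_, sq_pos' _ (n j hj), ?_⟩
      simp only [P, C, if_true, if_neg hj]
      exact (psi_cam0 _ _ _ _ (z j hj)).symm
    have A1 : ∀ i j, i ≠ 0 → j ≠ 0 → i ≠ j → Compat3 (F 0 i) (F 0 j) (F i j) →
        ∃ l : ℝ, l ≠ 0 ∧ l • F i j = psi (P i) (P j) := by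
      intro i j hi hj hij hc
      refine finish _ _ _ (T i j hi hj hij hc) ?_
      simp only [P, C, if_neg hi, if_neg hj]
      exact constr _ _ _ _ _ _ _ (fun h => hij (Fin.ext (by exact_mod_cast h.symm))) n0
        (n i hi) (n j hj) (z i hi) (z j hj) (w i hi) (w j hj)
    have all : ∀ i j, ∃ l : ℝ, i < j → l ≠ 0 ∧ l • F i j = psi (P i) (P j) := by
      intro i j
      by_cases hij : i < j
      · have : ∃ l : ℝ, l ≠ 0 ∧ l • F i j = psi (P i) (P j) := by
          by_cases hi : i = 0
          · subst hi
            exact A0 j hij.ne'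
          · have hj : j ≠ 0 := by rintro rfl; exact absurd hij (by simp)
            refine A1 i j hi hj hij.ne ?_
            have hcase : (i = 1 ∧ j = 2) ∨ (i = 1 ∧ j = 3) ∨ (i = 2 ∧ j = 3) := by omega
            rcases hcase with ⟨rfl, rfl⟩ | ⟨rfl, rfl⟩ | ⟨rfl, rfl⟩
            · exact h012
            · exact h013
            · exact h023
        obtain ⟨l, hl⟩ := this
        exact ⟨l, fun _ => hl⟩
      · exact ⟨0, fun h => absurd h hij⟩
    choose lam hlam using all
    refine ⟨P, lam, fun i => ?_, hlam⟩
    by_cases hi : i = 0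
    · simp only [P, if_pos hi]
      exact cam0_camera
    · simp only [P, C, if_neg hi]
      exact camj_camera _ _ _ _ (n i hi) (hrank _ _ (Ne.symm hi)) (z i hi)
end

section
/- Let n ≥ 3 and let {F^{ij} : 1 ≤ i < j ≤ n} be a compatible complete set of C(n,2) fundamental matrices. Suppose it is not the case that in every image all epipoles coincide, i.e., there exist an index j and indices i, k ≠ j with e_j^i not parallel to e_j^k. Then the solution is unique up to projective transformation: for any two solutions {Pᵢ} and {Qᵢ} there exist H ∈ GL₄(ℝ) and nonzero scalars μ₁,…,μₙ with Qᵢ = μᵢ Pᵢ H for all i. -/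
open Matrix

/-- `P` together with scalars `lam` is a solution of the complete family `F`. -/
def IsCompleteSolution (n : ℕ) (F : Fin n → Fin n → Matrix (Fin 3) (Fin 3) ℝ)
    (P : Fin n → Matrix (Fin 3) (Fin 4) ℝ) (lam : Fin n → Fin n → ℝ) : Prop :=
  (∀ i, IsCamera (P i)) ∧
    ∀ i j, i < j → lam i j ≠ 0 ∧ lam i j • F i j = psi (P i) (P j)

/-! ### Linear algebra -/

lemma ker_one {m k : ℕ} (A : Matrix (Fin m) (Fin (k+1)) ℝ) (h : A.rank = k) (c : Fin (k+1) → ℝ)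
    (hc : c ≠ 0) (hA : A *ᵥ c = 0) (x : Fin (k+1) → ℝ) (hx : A *ᵥ x = 0) : ∃ t : ℝ, x = t • c := by
  have h1 := A.mulVecLin.finrank_range_add_finrank_ker
  have h2 : Module.finrank ℝ (LinearMap.range A.mulVecLin) = k := h
  rw [h2] at h1
  have h3 : Module.finrank ℝ (LinearMap.ker A.mulVecLin) = 1 := by
    simp at h1; omega
  have := (finrank_eq_one_iff_of_nonzero' (⟨c, by simpa using hA⟩ : LinearMap.ker A.mulVecLin)
    (by simpa using hc)).1 h3 ⟨x, by simpa using hx⟩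
  obtain ⟨t, ht⟩ := this
  exact ⟨t, by simpa using (congrArg Subtype.val ht).symm⟩

lemma ker_ex {m k : ℕ} (A : Matrix (Fin m) (Fin (k+1)) ℝ) (h : A.rank = k) :
    ∃ c, c ≠ 0 ∧ A *ᵥ c = 0 := by
  have h1 := A.mulVecLin.finrank_range_add_finrank_ker
  have h2 : Module.finrank ℝ (LinearMap.range A.mulVecLin) = k := h
  rw [h2] at h1
  have h3 : 0 < Module.finrank ℝ (LinearMap.ker A.mulVecLin) := by
    simp at h1; omega
  rw [Module.finrank_pos_iff] at h3
  obtain ⟨c, hc⟩ := exists_ne (0 : LinearMap.ker A.mulVecLin)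
  exact ⟨c, by simpa using hc, LinearMap.mem_ker.1 c.2⟩

lemma rank_add_le_aux (A B : Matrix (Fin 3) (Fin 4) ℝ) : (A + B).rank ≤ A.rank + B.rank := by
  unfold Matrix.rank
  rw [Matrix.mulVecLin_add]
  exact (Submodule.finrank_mono (LinearMap.range_add_le _ _)).trans
    (Submodule.finrank_add_le_finrank_add_finrank _ _)

lemma right_inv (P : Matrix (Fin 3) (Fin 4) ℝ) (h : P.rank = 3) :
    ∃ R : Matrix (Fin 4) (Fin 3) ℝ, P * R = 1 := by
  have h2 : Module.finrank ℝ (LinearMap.range P.mulVecLin) = 3 := h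
  have h3 : LinearMap.range P.mulVecLin = ⊤ := by
    apply Submodule.eq_top_of_finrank_eq
    rw [h2]; simp
  have h4 : Function.Surjective P.mulVec := by
    intro y
    have : y ∈ LinearMap.range P.mulVecLin := by rw [h3]; trivial
    obtain ⟨x, hx⟩ := this
    exact ⟨x, hx⟩
  exact Matrix.mulVec_surjective_iff_exists_right_inverse.1 h4

lemma det_ne_of_inj {k : ℕ} (H : Matrix (Fin k) (Fin k) ℝ) (h : ∀ x, H *ᵥ x = 0 → x = 0) :
    H.det ≠ 0 := by
  intro hd
  obtain ⟨v, hv, hv2⟩ := Matrix.exists_mulVec_eq_zero_iff.2 hd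
  exact hv (h v hv2)

lemma skew_self (S : Matrix (Fin 4) (Fin 4) ℝ) (hS : Sᵀ = -S) (x y : Fin 4 → ℝ) :
    x ⬝ᵥ S *ᵥ y = -(y ⬝ᵥ S *ᵥ x) := by
  rw [Matrix.dotProduct_mulVec, ← Matrix.mulVec_transpose, hS, dotProduct_comm, Matrix.neg_mulVec,
    dotProduct_neg]

lemma skew_prop (S T : Matrix (Fin 4) (Fin 4) ℝ) (hS : Sᵀ = -S) (hT : Tᵀ = -T)
    (u v : Fin 4 → ℝ) (huv : ∀ a b : ℝ, a • u + b • v = 0 → a = 0 ∧ b = 0)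
    (hSu : S *ᵥ u = 0) (hSv : S *ᵥ v = 0) (hTu : T *ᵥ u = 0) (hTv : T *ᵥ v = 0) (hS0 : S ≠ 0) :
    ∃ s : ℝ, T = s • S := by
  obtain ⟨w, z, hwz⟩ : ∃ w z, w ⬝ᵥ S *ᵥ z ≠ 0 := by
    by_contra! hcon
    apply hS0
    ext i j
    have := hcon (Pi.single i 1) (Pi.single j 1)
    simpa using this
  have hww : ∀ (A : Matrix (Fin 4) (Fin 4) ℝ), Aᵀ = -A → ∀ x, x ⬝ᵥ A *ᵥ x = 0 := by
    intro A hA x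
    have := skew_self A hA x x
    linarith
  have hind : LinearIndependent ℝ ![u, v, w, z] := by
    rw [Fintype.linearIndependent_iff]
    intro g hg
    simp only [Fin.sum_univ_four] at hg
    have hg' : g 0 • u + g 1 • v + g 2 • w + g 3 • z = 0 := hg
    have e1 := congrArg (fun x => w ⬝ᵥ S *ᵥ x) hg'
    simp only [Matrix.mulVec_add, Matrix.mulVec_smul, hSu, hSv, dotProduct_add, dotProduct_smul,
      hww S hS, Matrix.mulVec_zero, dotProduct_zero, smul_eq_mul] at e1
    have e2 := congrArg (fun x => z ⬝ᵥ S *ᵥ x) hg'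
    simp only [Matrix.mulVec_add, Matrix.mulVec_smul, hSu, hSv, dotProduct_add, dotProduct_smul,
      hww S hS, Matrix.mulVec_zero, dotProduct_zero, smul_eq_mul, skew_self S hS z w] at e2
    have h3 : g 3 = 0 := by
      have : g 3 * (w ⬝ᵥ S *ᵥ z) = 0 := by linarith
      exact (mul_eq_zero.1 this).resolve_right hwz
    have h2 : g 2 = 0 := by
      have : g 2 * (w ⬝ᵥ S *ᵥ z) = 0 := by linarith
      exact (mul_eq_zero.1 this).resolve_right hwz
    rw [h2, h3] at hg'
    obtain ⟨h0, h1⟩ := huv (g 0) (g 1) (by simpa using hg')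
    intro i
    fin_cases i <;> assumption
  set B : Matrix (Fin 4) (Fin 4) ℝ := Matrix.of ![u, v, w, z] with hB
  have hBu : IsUnit B := Matrix.linearIndependent_rows_iff_isUnit.1 hind
  have hBi : Function.Injective B.mulVec := Matrix.mulVec_injective_iff_isUnit.2 hBu
  set s := (w ⬝ᵥ T *ᵥ z) / (w ⬝ᵥ S *ᵥ z) with hs
  refine ⟨s, ?_⟩
  set D := T - s • S with hD
  have hDs : Dᵀ = -D := by
    rw [hD, Matrix.transpose_sub, Matrix.transpose_smul, hS, hT]; simp; abel
  have hDu : D *ᵥ u = 0 := by simp [hD, Matrix.sub_mulVec, Matrix.smul_mulVec, hTu, hSu]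
  have hDv : D *ᵥ v = 0 := by simp [hD, Matrix.sub_mulVec, Matrix.smul_mulVec, hTv, hSv]
  have hDwz : w ⬝ᵥ D *ᵥ z = 0 := by
    simp only [hD, Matrix.sub_mulVec, Matrix.smul_mulVec, dotProduct_sub, dotProduct_smul,
      smul_eq_mul]
    rw [hs]; field_simp; ring
  have hker : ∀ x, w ⬝ᵥ D *ᵥ x = 0 → z ⬝ᵥ D *ᵥ x = 0 → D *ᵥ x = 0 := by
    intro x h1 h2
    apply hBi
    rw [Matrix.mulVec_zero]
    ext i
    have h3 : u ⬝ᵥ D *ᵥ x = 0 := by rw [skew_self D hDs, hDu]; simp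
    have h4 : v ⬝ᵥ D *ᵥ x = 0 := by rw [skew_self D hDs, hDv]; simp
    fin_cases i <;> assumption
  have hDw : D *ᵥ w = 0 := hker w (hww D hDs w) (by rw [skew_self D hDs, hDwz]; simp)
  have hDz : D *ᵥ z = 0 := hker z hDwz (hww D hDs z)
  have hall : ∀ x, D *ᵥ x = 0 := by
    intro x
    apply hBi
    rw [Matrix.mulVec_zero]
    ext i
    have h3 : u ⬝ᵥ D *ᵥ x = 0 := by rw [skew_self D hDs, hDu]; simp
    have h4 : v ⬝ᵥ D *ᵥ x = 0 := by rw [skew_self D hDs, hDv]; simp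
    have h5 : w ⬝ᵥ D *ᵥ x = 0 := by rw [skew_self D hDs, hDw]; simp
    have h6 : z ⬝ᵥ D *ᵥ x = 0 := by rw [skew_self D hDs, hDz]; simp
    fin_cases i <;> assumption
  have hD0 : D = 0 := by
    ext i j
    have := congrFun (hall (Pi.single j 1)) i
    simpa using this
  exact sub_eq_zero.1 hD0

/-! ### Pairs of cameras -/

/-- Pair data: skewness and distinct centers. -/
def Pair (F : Matrix (Fin 3) (Fin 3) ℝ) (P Q : Matrix (Fin 3) (Fin 4) ℝ) : Prop :=
  (Pᵀ * F * Q)ᵀ = -(Pᵀ * F * Q) ∧ ∀ x, P *ᵥ x = 0 → Q *ᵥ x = 0 → x = 0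

lemma Pair.symm {F P Q} (h : Pair F P Q) : Pair Fᵀ Q P := by
  refine ⟨?_, fun x h1 h2 => h.2 x h2 h1⟩
  have h1 : Qᵀ * Fᵀ * P = (Pᵀ * F * Q)ᵀ := by
    simp [Matrix.transpose_mul, Matrix.mul_assoc]
  rw [h1, h.1, Matrix.transpose_neg, h.1]

lemma Pair.transform {F P Q} (h : Pair F P Q) (H : Matrix (Fin 4) (Fin 4) ℝ) (hH : H.det ≠ 0)
    (a b : ℝ) (ha : a ≠ 0) (hb : b ≠ 0) : Pair F (a • (P * H)) (b • (Q * H)) := by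
  constructor
  · have h1 : (a • (P * H))ᵀ * F * (b • (Q * H)) = (a * b) • (Hᵀ * (Pᵀ * F * Q) * H) := by
      simp [Matrix.transpose_mul, Matrix.mul_assoc, smul_smul, mul_comm]
    rw [h1, Matrix.transpose_smul, Matrix.transpose_mul, Matrix.transpose_mul, h.1]
    simp [Matrix.mul_assoc]
  · intro x h1 h2
    rw [Matrix.smul_mulVec, smul_eq_zero_iff_right ha, ← Matrix.mulVec_mulVec] at h1
    rw [Matrix.smul_mulVec, smul_eq_zero_iff_right hb, ← Matrix.mulVec_mulVec] at h2
    have := h.2 _ h1 h2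
    exact Matrix.eq_zero_of_mulVec_eq_zero hH this

lemma camera_transform {P : Matrix (Fin 3) (Fin 4) ℝ} (h : P.rank = 3)
    (H : Matrix (Fin 4) (Fin 4) ℝ) (hH : H.det ≠ 0)
    (a : ℝ) (ha : a ≠ 0) : (a • (P * H)).rank = 3 := by
  rw [← Matrix.mul_smul, Matrix.rank_mul_eq_left_of_isUnit_det, h]
  rw [Matrix.det_smul]
  exact (mul_ne_zero (pow_ne_zero _ ha) hH).isUnit

lemma Pair.epi {F P Q} (h : Pair F P Q) (hP : P.rank = 3) (c : Fin 4 → ℝ) (hc : P *ᵥ c = 0) :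
    F *ᵥ (Q *ᵥ c) = 0 := by
  obtain ⟨R, hR⟩ := right_inv P hP
  have h1 : Pᵀ *ᵥ (F *ᵥ (Q *ᵥ c)) = 0 := by
    have h2 : (Pᵀ * F * Q) *ᵥ c = -((Pᵀ * F * Q)ᵀ *ᵥ c) := by
      rw [h.1, Matrix.neg_mulVec, neg_neg]
    rw [Matrix.mulVec_mulVec, Matrix.mulVec_mulVec, h2]
    simp [Matrix.transpose_mul, ← Matrix.mulVec_mulVec, hc]
  have h3 : Rᵀ * Pᵀ = 1 := by rw [← Matrix.transpose_mul, hR, Matrix.transpose_one]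
  have := congrArg (fun x => Rᵀ *ᵥ x) h1
  simpa [Matrix.mulVec_mulVec, ← Matrix.mul_assoc, h3] using this

lemma cancel {F : Matrix (Fin 3) (Fin 3) ℝ} {P : Matrix (Fin 3) (Fin 4) ℝ} (hP : P.rank = 3)
    {k : ℕ} (X : Matrix (Fin 3) (Fin k) ℝ) (h : Pᵀ * F * X = 0) : F * X = 0 := by
  obtain ⟨R, hR⟩ := right_inv P hP
  have h3 : Rᵀ * Pᵀ = 1 := by rw [← Matrix.transpose_mul, hR, Matrix.transpose_one]
  have := congrArg (fun x => Rᵀ * x) h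
  simpa [← Matrix.mul_assoc, h3] using this

lemma cancel_ne {F : Matrix (Fin 3) (Fin 3) ℝ} (hF : F.rank = 2)
    {P Q : Matrix (Fin 3) (Fin 4) ℝ} (hP : P.rank = 3)
    (hQ : Q.rank = 3) : Pᵀ * F * Q ≠ 0 := by
  intro h
  have h1 := cancel hP Q h
  obtain ⟨R, hR⟩ := right_inv Q hQ
  have : F = 0 := by
    rw [← Matrix.mul_one F, ← hR, ← Matrix.mul_assoc, h1, Matrix.zero_mul]
  rw [this, Matrix.rank_zero] at hF
  omega

lemma core_s17 (F : Matrix (Fin 3) (Fin 3) ℝ) (hF : F.rank = 2) (P P2 Q2 : Matrix (Fin 3) (Fin 4) ℝ)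
    (hP : P.rank = 3) (hP2 : P2.rank = 3) (hQ2 : Q2.rank = 3)
    (h : Pair F P P2) (h' : Pair F P Q2) (c : Fin 4 → ℝ) (hc : c ≠ 0) (hPc : P *ᵥ c = 0) :
    ∃ (s : ℝ) (b : Fin 4 → ℝ), s ≠ 0 ∧ Q2 = s • P2 + vecMulVec (P2 *ᵥ c) b := by
  obtain ⟨c2, hc2, hPc2⟩ := ker_ex P2 hP2
  obtain ⟨d2, hd2, hQd2⟩ := ker_ex Q2 hQ2
  have e1 := h.epi hP c hPc
  have e1' := h'.epi hP c hPc
  have e2 := h.symm.epi hP2 c2 hPc2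
  have e2' := h'.symm.epi hQ2 d2 hQd2
  have n2 : P *ᵥ c2 ≠ 0 := fun hh => hc2 (h.2 _ hh hPc2)
  have n2' : P *ᵥ d2 ≠ 0 := fun hh => hd2 (h'.2 _ hh hQd2)
  have n1 : P2 *ᵥ c ≠ 0 := fun hh => hc (h.2 _ hPc hh)
  have hFt : Fᵀ.rank = 2 := by rw [Matrix.rank_transpose, hF]
  obtain ⟨t, ht⟩ := ker_one Fᵀ hFt _ n2 e2 _ e2'
  obtain ⟨r, hr⟩ := ker_one P hP c hc hPc (d2 - t • c2) (by
    rw [Matrix.mulVec_sub, Matrix.mulVec_smul, ht, sub_self])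
  have ht0 : t ≠ 0 := by
    rintro rfl
    exact n2' (by simpa using ht)
  have hc2e : c2 = t⁻¹ • (d2 - r • c) := by
    rw [← hr]; simp [smul_smul, ht0]
  have hSc2 : (Pᵀ * F * Q2) *ᵥ c2 = 0 := by
    rw [hc2e]
    simp [Matrix.mulVec_smul, Matrix.mulVec_sub, ← Matrix.mulVec_mulVec, hQd2, e1']
  obtain ⟨s, hs⟩ := skew_prop (Pᵀ * F * P2) (Pᵀ * F * Q2) h.1 h'.1 c c2 (by
      intro a b hab
      have h1 := congrArg (fun x => P *ᵥ x) hab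
      simp only [Matrix.mulVec_add, Matrix.mulVec_smul, hPc, smul_zero, zero_add,
        Matrix.mulVec_zero] at h1
      have hb : b = 0 := (smul_eq_zero.1 h1).resolve_right n2
      subst hb
      simp only [zero_smul, add_zero] at hab
      exact ⟨(smul_eq_zero.1 hab).resolve_right hc, rfl⟩)
    (by simp [← Matrix.mulVec_mulVec, e1]) (by simp [← Matrix.mulVec_mulVec, hPc2])
    (by simp [← Matrix.mulVec_mulVec, e1']) hSc2 (cancel_ne hF hP hP2)
  have hs0 : s ≠ 0 := by
    rintro rfl
    exact cancel_ne hF hP hQ2 (by simpa using hs)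
  have h0 : F * (Q2 - s • P2) = 0 := by
    apply cancel hP
    rw [Matrix.mul_sub, Matrix.mul_smul, hs, sub_self]
  have hcol : ∀ j, ∃ t : ℝ, (Q2 - s • P2).col j = t • (P2 *ᵥ c) := by
    intro j
    apply ker_one F hF _ n1 e1
    have := congrArg (fun M => M *ᵥ (Pi.single j (1:ℝ))) h0
    simp only [← Matrix.mulVec_mulVec, Matrix.mulVec_single_one, Matrix.zero_mulVec] at this
    exact this
  choose b hb using hcol
  refine ⟨s, b, hs0, ?_⟩
  rw [← sub_eq_iff_eq_add']
  ext i j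
  have := congrFun (hb j) i
  simp only [Matrix.col_apply] at this
  rw [this, vecMulVec_apply, Pi.smul_apply, smul_eq_mul, mul_comm]

lemma pair_unique (F : Matrix (Fin 3) (Fin 3) ℝ) (hF : F.rank = 2)
    (P P2 Q Q2 : Matrix (Fin 3) (Fin 4) ℝ)
    (hP : P.rank = 3) (hP2 : P2.rank = 3) (hQ : Q.rank = 3) (hQ2 : Q2.rank = 3)
    (h : Pair F P P2) (h' : Pair F Q Q2) :
    ∃ (H : Matrix (Fin 4) (Fin 4) ℝ) (s : ℝ), H.det ≠ 0 ∧ s ≠ 0 ∧ Q = s • (P * H) ∧ Q2 = P2 * H := by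
  obtain ⟨R, hR⟩ := right_inv P hP
  obtain ⟨c, hc, hPc⟩ := ker_ex P hP
  obtain ⟨d, hd, hQd⟩ := ker_ex Q hQ
  set H0 := R * Q + vecMulVec c d with hH0
  have hPH : P * H0 = Q := by
    rw [hH0, Matrix.mul_add, ← Matrix.mul_assoc, hR, Matrix.one_mul, Matrix.mul_vecMulVec, hPc]
    simp
  have hdet : H0.det ≠ 0 := by
    apply det_ne_of_inj
    intro x hx
    have h1 : Q *ᵥ x = 0 := by rw [← hPH, ← Matrix.mulVec_mulVec, hx, Matrix.mulVec_zero]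
    obtain ⟨t, rfl⟩ := ker_one Q hQ d hd hQd x h1
    have h2 : (d ⬝ᵥ (t • d)) • c = 0 := by
      rw [hH0, Matrix.add_mulVec, ← Matrix.mulVec_mulVec, h1, Matrix.mulVec_zero, zero_add,
        Matrix.vecMulVec_mulVec] at hx
      rwa [op_smul_eq_smul] at hx
    have h3 := (smul_eq_zero.1 h2).resolve_right hc
    rw [dotProduct_smul, smul_eq_mul] at h3
    have h4 : t = 0 := (mul_eq_zero.1 h3).resolve_right (by simpa using hd)
    simp [h4]
  have hp := h.transform H0 hdet 1 1 one_ne_zero one_ne_zero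
  rw [one_smul, one_smul, hPH] at hp
  have hr2 : (P2 * H0).rank = 3 := by
    simpa using camera_transform hP2 H0 hdet 1 one_ne_zero
  obtain ⟨s, b, hs, hb⟩ := core_s17 F hF Q (P2 * H0) Q2 hQ hr2 hQ2 hp h' d hd hQd
  set H1 : Matrix (Fin 4) (Fin 4) ℝ := s • (1 : Matrix (Fin 4) (Fin 4) ℝ) + vecMulVec d b with hH1
  have e1 : Q * H1 = s • Q := by
    rw [hH1, Matrix.mul_add, Matrix.mul_smul, Matrix.mul_one, Matrix.mul_vecMulVec, hQd]
    simp
  have e2 : P2 * H0 * H1 = Q2 := by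
    rw [hH1, Matrix.mul_add, Matrix.mul_smul, Matrix.mul_one, Matrix.mul_vecMulVec, hb]
  have hdet1 : H1.det ≠ 0 := by
    apply det_ne_of_inj
    intro x hx
    apply h'.2
    · have : (Q * H1) *ᵥ x = 0 := by rw [← Matrix.mulVec_mulVec, hx, Matrix.mulVec_zero]
      rw [e1, Matrix.smul_mulVec] at this
      exact (smul_eq_zero.1 this).resolve_left hs
    · rw [← e2, ← Matrix.mulVec_mulVec, hx, Matrix.mulVec_zero]
  refine ⟨H0 * H1, s⁻¹, ?_, inv_ne_zero hs, ?_, ?_⟩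
  · rw [Matrix.det_mul]; exact mul_ne_zero hdet hdet1
  · rw [← Matrix.mul_assoc, hPH, e1, smul_smul, inv_mul_cancel₀ hs, one_smul]
  · rw [← Matrix.mul_assoc, e2]

lemma third_unique (F1 F2 : Matrix (Fin 3) (Fin 3) ℝ) (hF1 : F1.rank = 2) (hF2 : F2.rank = 2)
    (P1 P2 P Q : Matrix (Fin 3) (Fin 4) ℝ)
    (hP1 : P1.rank = 3) (hP2 : P2.rank = 3) (hP : P.rank = 3) (hQ : Q.rank = 3)
    (h1 : Pair F1 P1 P) (h1' : Pair F1 P1 Q) (h2 : Pair F2 P2 P) (h2' : Pair F2 P2 Q)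
    (c1 c2 : Fin 4 → ℝ) (hc1 : c1 ≠ 0) (hc2 : c2 ≠ 0) (hPc1 : P1 *ᵥ c1 = 0) (hPc2 : P2 *ᵥ c2 = 0)
    (hind : ∀ a b : ℝ, a • (P *ᵥ c1) + b • (P *ᵥ c2) = 0 → a = 0 ∧ b = 0) :
    ∃ s : ℝ, s ≠ 0 ∧ Q = s • P := by
  obtain ⟨s, b, hs, hb⟩ := core_s17 F1 hF1 P1 P Q hP1 hP hQ h1 h1' c1 hc1 hPc1
  obtain ⟨t, b', ht, hb'⟩ := core_s17 F2 hF2 P2 P Q hP2 hP hQ h2 h2' c2 hc2 hPc2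
  have hst : s = t := by
    by_contra hne
    have e : (s - t) • P = vecMulVec (P *ᵥ c2) b' + vecMulVec (P *ᵥ c1) (-b) := by
      have := hb.symm.trans hb'
      rw [sub_smul, Matrix.vecMulVec_neg, ← sub_eq_zero]
      rw [← sub_eq_zero] at this
      rw [← this]
      abel
    have r1 : ((s - t) • P).rank ≤ 1 + 1 := by
      rw [e]
      exact (rank_add_le_aux _ _).trans
        (add_le_add (Matrix.rank_vecMulVec_le _ _) (Matrix.rank_vecMulVec_le _ _))
    have r2 := camera_transform hP 1 (by simp) (s - t) (sub_ne_zero.2 hne)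
    rw [Matrix.mul_one] at r2
    omega
  subst hst
  have e : vecMulVec (P *ᵥ c1) b = vecMulVec (P *ᵥ c2) b' := by
    have := hb.symm.trans hb'
    exact add_left_cancel this
  refine ⟨s, hs, ?_⟩
  have hb0 : b = 0 := by
    ext j
    refine (hind (b j) (-b' j) ?_).1
    ext i
    have := congrFun (congrFun e i) j
    simp only [vecMulVec_apply] at this
    simp only [Pi.add_apply, Pi.smul_apply, smul_eq_mul, Pi.zero_apply]
    linarith
  rw [hb, hb0]; ext; simp [vecMulVec_apply]

/-! ### The determinant -/

lemma psi_bilin (P Q : Matrix (Fin 3) (Fin 4) ℝ) (x y : Fin 3 → ℝ) :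
    x ⬝ᵥ psi P Q *ᵥ y = (bigMat P Q x y).det := by
  set cx : (Fin 3 → ℝ) → (Fin 6 → ℝ) := fun x i => if hi : (i : ℕ) < 3 then x ⟨i, hi⟩ else 0 with hcx
  set cy : (Fin 3 → ℝ) → (Fin 6 → ℝ) := fun y i => if hi : (i : ℕ) < 3 then 0 else
    y ⟨(i : ℕ) - 3, by have := i.isLt; omega⟩ with hcy
  have hM : ∀ x y, bigMat P Q x y =
      ((bigMat P Q 0 0).updateCol 4 (cx x)).updateCol 5 (cy y) := by
    intro x y
    ext i j
    fin_cases j <;> simp [bigMat, hcx, hcy]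
  have hxa : ∀ x x' y, (bigMat P Q (x + x') y).det
      = (bigMat P Q x y).det + (bigMat P Q x' y).det := by
    intro x x' y
    have : cx (x + x') = cx x + cx x' := by
      ext i; simp only [hcx, Pi.add_apply]; split_ifs <;> simp
    rw [hM, hM x, hM x', this]
    rw [Matrix.updateCol_comm _ (by decide), Matrix.det_updateCol_add,
      Matrix.updateCol_comm _ (by decide), Matrix.updateCol_comm _ (by decide : (5 : Fin 6) ≠ 4)]
  have hxs : ∀ (a : ℝ) x y, (bigMat P Q (a • x) y).det = a * (bigMat P Q x y).det := by
    intro a x y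
    have : cx (a • x) = a • cx x := by
      ext i; simp only [hcx, Pi.smul_apply]; split_ifs <;> simp
    rw [hM, hM x, this]
    rw [Matrix.updateCol_comm _ (by decide), Matrix.det_updateCol_smul,
      Matrix.updateCol_comm _ (by decide)]
  have hya : ∀ x y y', (bigMat P Q x (y + y')).det
      = (bigMat P Q x y).det + (bigMat P Q x y').det := by
    intro x y y'
    have : cy (y + y') = cy y + cy y' := by
      ext i; simp only [hcy, Pi.add_apply]; split_ifs <;> simp
    rw [hM, hM x y, hM x y', this, Matrix.det_updateCol_add]
  have hys : ∀ (a : ℝ) x y, (bigMat P Q x (a • y)).det = a * (bigMat P Q x y).det := by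
    intro a x y
    have : cy (a • y) = a • cy y := by
      ext i; simp only [hcy, Pi.smul_apply]; split_ifs <;> simp
    rw [hM, hM x y, this, Matrix.det_updateCol_smul]
  have hdec : ∀ z : Fin 3 → ℝ, z = z 0 • Pi.single 0 1 + z 1 • Pi.single 1 1
      + z 2 • Pi.single 2 1 := by
    intro z; ext i; fin_cases i <;> simp
  conv_rhs => rw [hdec x, hdec y]
  simp only [hxa, hxs, hya, hys]
  simp only [Matrix.mulVec, dotProduct, Fin.sum_univ_three, psi]
  ring

lemma bigMat_kill (P Q : Matrix (Fin 3) (Fin 4) ℝ) (X : Fin 4 → ℝ) (a b : ℝ)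
    (x y : Fin 3 → ℝ) (hx : P *ᵥ X + a • x = 0) (hy : Q *ᵥ X + b • y = 0)
    (hn : X ≠ 0 ∨ a ≠ 0) : (bigMat P Q x y).det = 0 := by
  apply Matrix.exists_mulVec_eq_zero_iff.1
  refine ⟨![X 0, X 1, X 2, X 3, a, b], ?_, ?_⟩
  · intro h0
    have h := fun i => congrFun h0 i
    rcases hn with hn | hn
    · apply hn
      ext i
      fin_cases i
      · exact h 0
      · exact h 1
      · exact h 2
      · exact h 3
    · exact hn (h 4)
  · ext i
    have hx' := fun i => congrFun hx i
    have hy' := fun i => congrFun hy i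
    simp only [Matrix.mulVec, dotProduct, Fin.sum_univ_four, Pi.add_apply, Pi.smul_apply,
      Pi.zero_apply, smul_eq_mul] at hx' hy'
    have x0 := hx' 0
    have x1 := hx' 1
    have x2 := hx' 2
    have y0 := hy' 0
    have y1 := hy' 1
    have y2 := hy' 2
    fin_cases i <;> simp [Matrix.mulVec, dotProduct, Fin.sum_univ_six, bigMat] <;> linarith

lemma pair_of_psi (F : Matrix (Fin 3) (Fin 3) ℝ) (hF : F.rank = 2)
    (P Q : Matrix (Fin 3) (Fin 4) ℝ) (l : ℝ) (hl : l ≠ 0) (h : l • F = psi P Q) : Pair F P Q := by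
  have hq : ∀ X, X ⬝ᵥ (Pᵀ * F * Q) *ᵥ X = 0 := by
    intro X
    have h1 : (P *ᵥ X) ⬝ᵥ psi P Q *ᵥ (Q *ᵥ X) = 0 := by
      rw [psi_bilin]
      by_cases hX : X = 0
      · exact bigMat_kill P Q 0 1 1 _ _ (by simp [hX]) (by simp [hX]) (Or.inr one_ne_zero)
      · exact bigMat_kill P Q X (-1) (-1) _ _ (by simp) (by simp) (Or.inl hX)
    rw [← h, Matrix.smul_mulVec, dotProduct_smul, smul_eq_mul] at h1
    have h2 := (mul_eq_zero.1 h1).resolve_left hl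
    rw [← h2, ← Matrix.mulVec_mulVec, ← Matrix.mulVec_mulVec, Matrix.dotProduct_mulVec X Pᵀ,
      Matrix.vecMul_transpose]
  constructor
  · ext i j
    set S := Pᵀ * F * Q
    have h1 := hq (Pi.single i 1 + Pi.single j 1)
    have h2 := hq (Pi.single i 1)
    have h3 := hq (Pi.single j 1)
    simp only [Matrix.mulVec_add, dotProduct_add, add_dotProduct, h2, h3] at h1
    simp at h1
    simp
    linarith
  · intro x h1 h2
    by_contra hx
    have h0 : psi P Q = 0 := by
      ext a b
      exact bigMat_kill P Q x 0 0 _ _ (by simp [h1]) (by simp [h2]) (Or.inl hx)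
    rw [h0] at h
    have := (smul_eq_zero.1 h).resolve_left hl
    rw [this, Matrix.rank_zero] at hF
    omega

lemma Pair.scale {F P Q} (h : Pair F P Q) (a : ℝ) (ha : a ≠ 0) : Pair F (a • P) Q := by
  simpa using h.transform 1 (by simp) a 1 ha one_ne_zero

lemma Pair.unscale {F P Q} {a : ℝ} (ha : a ≠ 0) (h : Pair F (a • P) Q) : Pair F P Q := by
  have := h.scale a⁻¹ (inv_ne_zero ha)
  rwa [smul_smul, inv_mul_cancel₀ ha, one_smul] at this

lemma sol_of (n : ℕ) (F : Fin n → Fin n → Matrix (Fin 3) (Fin 3) ℝ)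
    (hsym : ∀ i j, F j i = (F i j)ᵀ)
    (hrank : ∀ i j, i ≠ j → (F i j).rank = 2) (P : Fin n → Matrix (Fin 3) (Fin 4) ℝ)
    (lam : Fin n → Fin n → ℝ) (h : IsCompleteSolution n F P lam) :
    ∀ i j, i ≠ j → Pair (F i j) (P i) (P j) := by
  have h0 : ∀ i j, i < j → Pair (F i j) (P i) (P j) := fun i j hij =>
    pair_of_psi (F i j) (hrank i j hij.ne) _ _ _ (h.2 i j hij).1 (h.2 i j hij).2
  intro i j hij
  rcases lt_or_gt_of_ne hij with h1 | h1
  · exact h0 i j h1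
  · rw [hsym j i]
    exact (h0 j i h1).symm

lemma main_aux (n : ℕ) (F : Fin n → Fin n → Matrix (Fin 3) (Fin 3) ℝ)
    (hrank : ∀ i j, i ≠ j → (F i j).rank = 2)
    (e : Fin n → Fin n → (Fin 3 → ℝ))
    (he : ∀ i j, i ≠ j → e i j ≠ 0 ∧ F i j *ᵥ e i j = 0)
    (P Q : Fin n → Matrix (Fin 3) (Fin 4) ℝ)
    (rP : ∀ i, (P i).rank = 3) (rQ : ∀ i, (Q i).rank = 3)
    (sP : ∀ i j, i ≠ j → Pair (F i j) (P i) (P j))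
    (sQ : ∀ i j, i ≠ j → Pair (F i j) (Q i) (Q j))
    (j i k : Fin n) (hij : i ≠ j) (hkj : k ≠ j) (hik : i ≠ k)
    (hpar : ¬ ∃ c : ℝ, e i j = c • e k j) (hQi : Q i = P i) (hQj : Q j = P j) :
    ∀ l, ∃ μ : ℝ, μ ≠ 0 ∧ Q l = μ • P l := by
  choose c hc0 hc using fun l => ker_ex (P l) (rP l)
  have hne0 : ∀ l m, l ≠ m → P l *ᵥ c m ≠ 0 := fun l m hlm hh =>
    hc0 m ((sP l m hlm).2 _ hh (hc m))
  have hind2 : ∀ a b : ℝ, a • (P j *ᵥ c i) + b • (P j *ᵥ c k) = 0 → a = 0 ∧ b = 0 := by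
    intro a b hab
    obtain ⟨t, ht⟩ := ker_one (F i j) (hrank i j hij) _ (he i j hij).1 (he i j hij).2 _
      ((sP i j hij).epi (rP i) (c i) (hc i))
    obtain ⟨u, hu⟩ := ker_one (F k j) (hrank k j hkj) _ (he k j hkj).1 (he k j hkj).2 _
      ((sP k j hkj).epi (rP k) (c k) (hc k))
    have ht0 : t ≠ 0 := by
      rintro rfl
      exact hne0 j i hij.symm (by simpa using ht)
    have ha : a = 0 := by
      by_contra ha
      apply hpar
      refine ⟨-((a * t)⁻¹ * (b * u)), ?_⟩
      have h1 : (a * t) • e i j = -((b * u) • e k j) := by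
        rw [ht, hu, smul_smul, smul_smul] at hab
        exact eq_neg_of_add_eq_zero_left hab
      have h2 := congrArg (fun x => (a * t)⁻¹ • x) h1
      simp only [smul_smul, smul_neg, inv_mul_cancel₀ (mul_ne_zero ha ht0), one_smul] at h2
      rw [h2, neg_smul]
    subst ha
    rw [zero_smul, zero_add] at hab
    exact ⟨rfl, (smul_eq_zero.1 hab).resolve_right (hne0 j k hkj.symm)⟩
  have hind3 : ∀ a b d : ℝ, a • c i + b • c j + d • c k = 0 → a = 0 ∧ b = 0 ∧ d = 0 := by
    intro a b d h
    have h1 := congrArg (fun x => P j *ᵥ x) h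
    simp only [Matrix.mulVec_add, Matrix.mulVec_smul, hc, smul_zero, add_zero,
      Matrix.mulVec_zero] at h1
    obtain ⟨rfl, rfl⟩ := hind2 a d h1
    simp only [zero_smul, zero_add, add_zero] at h
    exact ⟨rfl, (smul_eq_zero.1 h).resolve_right (hc0 j), rfl⟩
  have claim : ∀ p q l, p ≠ l → q ≠ l → (∃ μ : ℝ, μ ≠ 0 ∧ Q p = μ • P p) →
      (∃ μ : ℝ, μ ≠ 0 ∧ Q q = μ • P q) →
      (∀ a b : ℝ, a • (P l *ᵥ c p) + b • (P l *ᵥ c q) = 0 → a = 0 ∧ b = 0) →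
      ∃ μ : ℝ, μ ≠ 0 ∧ Q l = μ • P l := by
    rintro p q l hpl hql ⟨μ, hμ, hp⟩ ⟨ν, hν, hq⟩ hind
    have h1 := sQ p l hpl
    have h2 := sQ q l hql
    rw [hp] at h1
    rw [hq] at h2
    exact third_unique (F p l) (F q l) (hrank p l hpl) (hrank q l hql) (P p) (P q) (P l) (Q l)
      (rP p) (rP q) (rP l) (rQ l) (sP p l hpl) (h1.unscale hμ) (sP q l hql) (h2.unscale hν)
      (c p) (c q) (hc0 p) (hc0 q) (hc p) (hc q) hind
  have ki : ∃ μ : ℝ, μ ≠ 0 ∧ Q i = μ • P i := ⟨1, one_ne_zero, by simp [hQi]⟩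
  have kj : ∃ μ : ℝ, μ ≠ 0 ∧ Q j = μ • P j := ⟨1, one_ne_zero, by simp [hQj]⟩
  have conv : ∀ l p q (a b : ℝ), a • (P l *ᵥ c p) + b • (P l *ᵥ c q) = 0 →
      ∃ t : ℝ, a • c p + b • c q = t • c l := by
    intro l p q a b h
    apply ker_one (P l) (rP l) _ (hc0 l) (hc l)
    simpa only [Matrix.mulVec_add, Matrix.mulVec_smul] using h
  have kk : ∃ μ : ℝ, μ ≠ 0 ∧ Q k = μ • P k := by
    apply claim i j k hik hkj.symm ki kj
    intro a b h
    obtain ⟨t, ht⟩ := conv _ _ _ _ _ h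
    obtain ⟨h1, h2, -⟩ := hind3 a b (-t) (by rw [ht]; simp)
    exact ⟨h1, h2⟩
  intro l
  by_cases hli : l = i
  · rwa [hli]
  by_cases hlj : l = j
  · rwa [hlj]
  by_cases hlk : l = k
  · rwa [hlk]
  by_cases d1 : ∀ a b : ℝ, a • (P l *ᵥ c i) + b • (P l *ᵥ c j) = 0 → a = 0 ∧ b = 0
  · exact claim i j l (Ne.symm hli) (Ne.symm hlj) ki kj d1
  apply claim i k l (Ne.symm hli) (Ne.symm hlk) ki kk
  intro a' b' h'
  push Not at d1
  obtain ⟨a, b, h, hab⟩ := d1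
  obtain ⟨t, ht⟩ := conv _ _ _ _ _ h
  obtain ⟨t', ht'⟩ := conv _ _ _ _ _ h'
  have ht0 : t ≠ 0 := by
    rintro rfl
    obtain ⟨h1, h2, -⟩ := hind3 a b 0 (by simpa using ht)
    exact hab h1 h2
  obtain ⟨h1, h2, h3⟩ := hind3 (t' * a - t * a') (t' * b) (-(t * b')) (by
    have : t' • (a • c i + b • c j) - t • (a' • c i + b' • c k) = 0 := by
      rw [ht, ht', smul_smul, smul_smul, mul_comm, sub_self]
    rw [← this]
    module)
  have hb' : b' = 0 := by
    have : t * b' = 0 := by linarith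
    exact (mul_eq_zero.1 this).resolve_left ht0
  subst hb'
  rw [zero_smul, add_zero] at h'
  exact ⟨(smul_eq_zero.1 h').resolve_right (hne0 l i hli), rfl⟩

/-- a compatible complete set of fundamental matrices, not all of whose
epipoles coincide in every image, has a unique solution up to projective transformation.
Here `e i j` denotes the epipole `e_j^i`. -/
theorem stmt17 (n : ℕ) (hn : 3 ≤ n)
    (F : Fin n → Fin n → Matrix (Fin 3) (Fin 3) ℝ)
    (hsym : ∀ i j, F j i = (F i j)ᵀ)
    (hrank : ∀ i j, i ≠ j → (F i j).rank = 2)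
    (e : Fin n → Fin n → (Fin 3 → ℝ))
    (he : ∀ i j, i ≠ j → e i j ≠ 0 ∧ F i j *ᵥ e i j = 0)
    (hcompat : ∃ P lam, IsCompleteSolution n F P lam)
    (hne : ∃ j i k : Fin n, i ≠ j ∧ k ≠ j ∧ ¬ ∃ c : ℝ, e i j = c • e k j) :
    ∀ (P Q : Fin n → Matrix (Fin 3) (Fin 4) ℝ) (lamP lamQ : Fin n → Fin n → ℝ),
      IsCompleteSolution n F P lamP → IsCompleteSolution n F Q lamQ →
      ∃ (H : Matrix (Fin 4) (Fin 4) ℝ) (μ : Fin n → ℝ),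
        H.det ≠ 0 ∧ ∀ i, μ i ≠ 0 ∧ Q i = μ i • (P i * H) := by
  intro P Q lamP lamQ hP hQ
  have sP := sol_of n F hsym hrank P lamP hP
  have sQ := sol_of n F hsym hrank Q lamQ hQ
  obtain ⟨j, i, k, hij, hkj, hpar⟩ := hne
  have hik : i ≠ k := by
    rintro rfl
    exact hpar ⟨1, by simp⟩
  obtain ⟨H, s, hH, hs, hQi, hQj⟩ := pair_unique (F i j) (hrank i j hij) (P i) (P j) (Q i) (Q j)
    (hP.1 i) (hP.1 j) (hQ.1 i) (hQ.1 j) (sP i j hij) (sQ i j hij)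
  have key := main_aux n F hrank e he (fun l => if l = i then s • (P l * H) else P l * H) Q
    (by
      intro l
      by_cases hl : l = i
      · simpa [hl] using camera_transform (hP.1 i) H hH s hs
      · simpa [hl] using camera_transform (hP.1 l) H hH 1 one_ne_zero)
    hQ.1
    (by
      intro l m hlm
      have := (sP l m hlm).transform H hH (if l = i then s else 1) (if m = i then s else 1)
        (by split_ifs <;> simp [hs]) (by split_ifs <;> simp [hs])
      convert this using 1
      · split_ifs <;> simp
      · split_ifs <;> simp)
    sQ j i k hij hkj hik hpar (by simp [hQi]) (by simp [hij.symm, hQj])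
  choose μ hμ hQμ using key
  refine ⟨H, fun l => μ l * (if l = i then s else 1), hH, fun l => ⟨?_, ?_⟩⟩
  · have := hμ l
    by_cases hl : l = i
    · simpa [hl, hs] using hμ i
    · simpa [hl] using this
  · rw [hQμ l]
    by_cases hl : l = i
    · simp [hl, smul_smul]
    · simp [hl]
end
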